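/- Let p ∈ ℝ_{≥0}, let f ∈ C^∞(ℝ) be real-valued such that f' is of precise order −p−1, let λ_0 ∈ ℝ be such that f'(λ_0) = 0, and let n ≥ 1. Then there exist R, c_2 > 0 such that for all real numbers x_1, …, x_n satisfying R < |x_1| ≤ ⋯ ≤ |x_n|, one has |f'{λ_0, x_1, …, x_n}| ≤ c_2 |x_1|^{−p−1}. -/

import Mathlib

open MeasureTheory

/-- Divided difference of order `n-1` of `f` at the `n` points `x`, defined via the
integral formula over the simplex (and set to `0` for the empty tuple). -/
noncomputable def divDiff (f : ℝ → ℝ) : {n : ℕ} → (Fin n → ℝ) → ℝ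
  | 0, _ => 0
  | m + 1, x =>
    ∫ t in {t : Fin m → ℝ | Monotone t ∧ ∀ j, t j ∈ Set.Icc (0 : ℝ) 1},
      iteratedDeriv m f (x (Fin.last m) + ∑ j : Fin m, (x j.castSucc - x j.succ) * t j)

/-- Weighted divided difference `f'{x_1,…,x_n} = (−1)^n x_1⋯x_n f'[x_1,…,x_n]`. -/
noncomputable def wDivDiff (f : ℝ → ℝ) {n : ℕ} (x : Fin n → ℝ) : ℝ :=
  (-1 : ℝ) ^ n * (∏ j, x j) * divDiff (deriv f) x

/-- `f` is of precise order `r`: for every `k` there are `R, c₁, c₂ > 0` with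
`c₁ |x|^(r-k) ≤ |f^(k)(x)| ≤ c₂ |x|^(r-k)` for all `|x| > R`. -/
def PreciseOrder (f : ℝ → ℝ) (r : ℝ) : Prop :=
  ∀ k : ℕ, ∃ R c₁ c₂ : ℝ, 0 < R ∧ 0 < c₁ ∧ 0 < c₂ ∧
    ∀ x : ℝ, R < |x| →
      c₁ * |x| ^ (r - (k : ℝ)) ≤ |iteratedDeriv k f x| ∧
        |iteratedDeriv k f x| ≤ c₂ * |x| ^ (r - (k : ℝ))

/-- The sequence `0, t 0, …, t (m-1), 1, 1, …`. -/
noncomputable def simplexKnot {m : ℕ} (t : Fin m → ℝ) (i : ℕ) : ℝ :=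
  if i = 0 then 0 else if h : i - 1 < m then t ⟨i - 1, h⟩ else 1

theorem simplexKnot_zero {m : ℕ} (t : Fin m → ℝ) : simplexKnot t 0 = 0 := by
  simp [simplexKnot]

theorem simplexKnot_succ {m : ℕ} (t : Fin m → ℝ) (j : Fin m) :
    simplexKnot t (j + 1) = t j := by
  simp [simplexKnot]

theorem simplexKnot_of_lt {m : ℕ} (t : Fin m → ℝ) {i : ℕ} (h : m < i) :
    simplexKnot t i = 1 := by
  have h1 : ¬ i = 0 := by omega
  have h2 : ¬ i - 1 < m := by omega
  simp [simplexKnot, h1, h2]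

/-- The set over which divided differences are integrated. -/
def orderedSimplex (m : ℕ) : Set (Fin m → ℝ) :=
  {t | Monotone t ∧ ∀ j, t j ∈ Set.Icc (0 : ℝ) 1}

/-- The argument of the integrand of a divided difference. -/
def simplexPoint {m : ℕ} (x : Fin (m + 1) → ℝ) (t : Fin m → ℝ) : ℝ :=
  x (Fin.last m) + ∑ j : Fin m, (x j.castSucc - x j.succ) * t j

theorem divDiff_eq (f : ℝ → ℝ) {m : ℕ} (x : Fin (m + 1) → ℝ) :
    divDiff f x = ∫ t in orderedSimplex m, iteratedDeriv m f (simplexPoint x t) := rfl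

theorem mem_orderedSimplex_iff {m : ℕ} (t : Fin m → ℝ) :
    t ∈ orderedSimplex m ↔ Monotone (simplexKnot t) := by
  constructor
  · rintro ⟨h1, h2⟩
    refine monotone_nat_of_le_succ fun i => ?_
    rcases Nat.eq_zero_or_pos i with rfl | hi
    · rw [simplexKnot_zero]
      by_cases hm : 0 < m
      · exact (simplexKnot_succ t ⟨0, hm⟩).symm ▸ (h2 _).1
      · rw [simplexKnot_of_lt t (by omega)]; exact zero_le_one
    · obtain ⟨i, rfl⟩ := Nat.exists_eq_add_of_le' hi
      by_cases hm : i + 1 < m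
      · have e1 := simplexKnot_succ t ⟨i, by omega⟩
        have e2 := simplexKnot_succ t ⟨i + 1, hm⟩
        simp only at e1 e2
        rw [e1, e2]
        exact h1 (by simp)
      · rw [simplexKnot_of_lt t (i := i + 1 + 1) (by omega)]
        by_cases hm' : i < m
        · have e1 := simplexKnot_succ t ⟨i, hm'⟩
          simp only at e1
          rw [e1]
          exact (h2 _).2
        · rw [simplexKnot_of_lt t (by omega)]
  · intro h
    refine ⟨fun i j hij => ?_, fun j => ⟨?_, ?_⟩⟩
    · rw [← simplexKnot_succ t i, ← simplexKnot_succ t j]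
      exact h (by simpa using hij)
    · rw [← simplexKnot_succ t j, ← simplexKnot_zero t]
      exact h (by omega)
    · rw [← simplexKnot_succ t j, ← simplexKnot_of_lt t (lt_add_one m)]
      exact h (by omega)

theorem simplexPoint_eq_sum {m : ℕ} (x : Fin (m + 1) → ℝ) (t : Fin m → ℝ) :
    simplexPoint x t = ∑ i : Fin (m + 1), x i * (simplexKnot t (i + 1) - simplexKnot t i) := by
  simp only [mul_sub, Finset.sum_sub_distrib]
  rw [Fin.sum_univ_castSucc (fun i : Fin (m + 1) => x i * simplexKnot t (i + 1)),
    Fin.sum_univ_succ (fun i : Fin (m + 1) => x i * simplexKnot t i)]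
  simp only [Fin.val_castSucc, Fin.val_succ, Fin.val_last, Fin.val_zero, simplexKnot_succ,
    simplexKnot_zero, simplexKnot_of_lt t (lt_add_one m), simplexPoint, sub_mul,
    Finset.sum_sub_distrib]
  ring

theorem simplexKnot_insertNth {m : ℕ} (k : Fin (m + 1)) (s : ℝ) (u : Fin m → ℝ) (i : ℕ) :
    simplexKnot (k.insertNth s u : Fin (m + 1) → ℝ) i =
      if i ≤ k then simplexKnot u i else if i = k + 1 then s else simplexKnot u (i - 1) := by
  rcases Nat.eq_zero_or_pos i with rfl | hi
  · simp [simplexKnot_zero]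
  obtain ⟨i, rfl⟩ := Nat.exists_eq_add_of_le' hi
  by_cases hm : i < m + 1
  · have e := simplexKnot_succ (k.insertNth s u : Fin (m + 1) → ℝ) ⟨i, hm⟩
    simp only at e
    rw [e]
    rcases Fin.eq_self_or_eq_succAbove k ⟨i, hm⟩ with h | ⟨j, hj⟩
    · have hk : i = (k : ℕ) := by rw [← h]
      rw [h, Fin.insertNth_apply_same]
      simp [hk]
    · rw [hj, Fin.insertNth_apply_succAbove, ← simplexKnot_succ u j]
      have hv := congrArg Fin.val hj
      simp only [Fin.succAbove, Fin.lt_def, Fin.val_castSucc] at hv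
      split_ifs at hv with h1
      · simp only [Fin.val_castSucc] at hv
        rw [if_pos (by omega), hv]
      · simp only [Fin.val_succ] at hv
        rw [if_neg (by omega), if_neg (by omega)]
        congr 1
        omega
  · have := k.isLt
    rw [simplexKnot_of_lt _ (by omega), if_neg (by omega), if_neg (by omega),
      simplexKnot_of_lt _ (by omega)]

theorem insertNth_mem_orderedSimplex_iff {m : ℕ} (k : Fin (m + 1)) (s : ℝ) (u : Fin m → ℝ) :
    (k.insertNth s u : Fin (m + 1) → ℝ) ∈ orderedSimplex (m + 1) ↔
      u ∈ orderedSimplex m ∧ s ∈ Set.Icc (simplexKnot u k) (simplexKnot u (k + 1)) := by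
  rw [mem_orderedSimplex_iff, mem_orderedSimplex_iff]
  constructor
  · intro h
    have key : ∀ i, simplexKnot (k.insertNth s u : Fin (m + 1) → ℝ) i ≤ _ :=
      fun i => h (Nat.le_succ i)
    have h1 := key k
    have h2 := key (k + 1)
    simp only [simplexKnot_insertNth] at h1 h2
    simp at h1 h2
    refine ⟨monotone_nat_of_le_succ fun i => ?_, h1, h2⟩
    rcases lt_trichotomy i k with hi | hi | hi
    · have h3 := key i
      simp only [simplexKnot_insertNth] at h3
      rwa [if_pos (by omega), if_pos (by omega)] at h3
    · rw [hi]; exact h1.trans h2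
    · have h3 := key (i + 1)
      simp only [simplexKnot_insertNth] at h3
      rwa [if_neg (by omega), if_neg (by omega), if_neg (by omega), if_neg (by omega)] at h3
  · rintro ⟨h, h1, h2⟩
    refine monotone_nat_of_le_succ fun i => ?_
    simp only [simplexKnot_insertNth]
    rcases lt_trichotomy i k with hi | hi | hi
    · rw [if_pos (by omega), if_pos (by omega)]; exact h (by omega)
    · rw [if_pos (by omega), if_neg (by omega), if_pos (by omega), hi]; exact h1
    · rw [if_neg (by omega), if_neg (by omega : ¬ i + 1 ≤ k), if_neg (by omega : ¬ i + 1 = k + 1)]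
      split_ifs with h3
      · rw [h3]; exact h2
      · exact h (by omega)

theorem simplexPoint_insertNth_knot {m : ℕ} (x : Fin (m + 2) → ℝ) (k : Fin (m + 1))
    (u : Fin m → ℝ) :
    simplexPoint x (k.insertNth (simplexKnot u k) u) =
        simplexPoint (x ∘ k.castSucc.succAbove) u ∧
      simplexPoint x (k.insertNth (simplexKnot u (k + 1)) u) =
        simplexPoint (x ∘ k.succ.succAbove) u := by
  simp only [simplexPoint_eq_sum]
  constructor
  · rw [Fin.sum_univ_succAbove _ k.castSucc]
    simp only [simplexKnot_insertNth]
    simp only [Fin.val_castSucc, le_refl, if_true, Nat.not_succ_le_self, if_false, sub_self,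
      mul_zero, zero_add, Function.comp]
    refine Finset.sum_congr rfl fun i _ => ?_
    congr 1
    simp only [Fin.succAbove, Fin.lt_def, Fin.val_castSucc]
    split_ifs with h h1 h2 h3 h4 h5 h6 <;> simp_all <;> grind
  · rw [Fin.sum_univ_succAbove _ k.succ]
    simp only [simplexKnot_insertNth]
    simp only [Fin.val_succ, Nat.not_succ_le_self, if_false, if_true, Function.comp]
    rw [if_neg (by omega), if_neg (by omega)]
    simp only [Nat.add_sub_cancel, sub_self, mul_zero, zero_add]
    refine Finset.sum_congr rfl fun i _ => ?_
    congr 1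
    simp only [Fin.succAbove, Fin.lt_def, Fin.val_castSucc, Fin.val_succ]
    split_ifs with h h1 h2 h3 h4 h5 h6 <;> simp_all <;> grind

theorem simplexPoint_insertNth {m : ℕ} (x : Fin (m + 2) → ℝ) (k : Fin (m + 1))
    (s : ℝ) (u : Fin m → ℝ) :
    simplexPoint x (k.insertNth s u) = (x k.castSucc - x k.succ) * s +
      (x (Fin.last _) + ∑ j, (x (k.succAbove j).castSucc - x (k.succAbove j).succ) * u j) := by
  rw [simplexPoint, Fin.sum_univ_succAbove _ k]
  simp only [Fin.insertNth_apply_same, Fin.insertNth_apply_succAbove]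
  ring

theorem isCompact_orderedSimplex (m : ℕ) : IsCompact (orderedSimplex m) := by
  have h : orderedSimplex m =
      {t | Monotone t} ∩ Set.univ.pi fun _ => Set.Icc (0 : ℝ) 1 := by
    ext t; simp only [orderedSimplex, Set.mem_inter_iff, Set.mem_ofPred_eq, Set.mem_univ_pi]
  rw [h]
  exact (isCompact_univ_pi fun _ => isCompact_Icc).inter_left isClosed_monotone

theorem measurableSet_orderedSimplex (m : ℕ) : MeasurableSet (orderedSimplex m) :=
  (isCompact_orderedSimplex m).isClosed.measurableSet

theorem continuous_simplexPoint {m : ℕ} (x : Fin (m + 1) → ℝ) : Continuous (simplexPoint x) := by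
  unfold simplexPoint
  fun_prop

theorem setIntegral_orderedSimplex_succ {m : ℕ} (k : Fin (m + 1)) (h : (Fin (m + 1) → ℝ) → ℝ)
    (hc : Continuous h) :
    ∫ t in orderedSimplex (m + 1), h t =
      ∫ u in orderedSimplex m, ∫ s in simplexKnot u k..simplexKnot u (k + 1),
        h (k.insertNth s u) := by
  have hint : Integrable ((orderedSimplex (m + 1)).indicator h) :=
    (integrable_indicator_iff (measurableSet_orderedSimplex _)).2
      (hc.continuousOn.integrableOn_compact (isCompact_orderedSimplex _))
  have hmp := (volume_preserving_piFinSuccAbove (fun _ => ℝ) k).symm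
  rw [← integral_indicator (measurableSet_orderedSimplex _),
    ← hmp.integral_comp (MeasurableEquiv.measurableEmbedding _),
    Measure.volume_eq_prod, integral_prod_symm]
  · rw [← integral_indicator (measurableSet_orderedSimplex _)]
    refine integral_congr_ae (Filter.Eventually.of_forall fun u => ?_)
    change ∫ s, (orderedSimplex (m + 1)).indicator h (k.insertNth s u) = _
    by_cases hu : u ∈ orderedSimplex m
    · have hle : simplexKnot u k ≤ simplexKnot u (k + 1) :=
        (mem_orderedSimplex_iff u).1 hu (Nat.le_succ _)
      rw [Set.indicator_of_mem hu, intervalIntegral.integral_of_le hle,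
        ← integral_Icc_eq_integral_Ioc, ← integral_indicator measurableSet_Icc]
      congr 1
      ext s
      by_cases hs : s ∈ Set.Icc (simplexKnot u k) (simplexKnot u (k + 1))
      · rw [Set.indicator_of_mem hs]
        exact Set.indicator_of_mem ((insertNth_mem_orderedSimplex_iff k s u).2 ⟨hu, hs⟩) h
      · rw [Set.indicator_of_notMem hs]
        exact Set.indicator_of_notMem
          (fun h' => hs ((insertNth_mem_orderedSimplex_iff k s u).1 h').2) h
    · rw [Set.indicator_of_notMem hu]
      have hzero : ∀ s, (orderedSimplex (m + 1)).indicator h (k.insertNth s u) = 0 := fun s =>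
        Set.indicator_of_notMem (fun h' => hu ((insertNth_mem_orderedSimplex_iff k s u).1 h').1) h
      simp only [hzero, integral_zero]
  · rw [← Measure.volume_eq_prod]
    exact (hmp.integrable_comp_emb (MeasurableEquiv.measurableEmbedding _)).2 hint

/-- Recursion for divided differences at two adjacent nodes. -/
theorem divDiff_recursion_adjacent {g : ℝ → ℝ} (hg : ContDiff ℝ (⊤ : ℕ∞) g) {m : ℕ}
    (x : Fin (m + 2) → ℝ) (k : Fin (m + 1)) :
    (x k.castSucc - x k.succ) * divDiff g x =
      divDiff g (x ∘ k.succ.succAbove) - divDiff g (x ∘ k.castSucc.succAbove) := by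
  have hcont : ∀ j, Continuous (iteratedDeriv j g) := fun j =>
    hg.continuous_iteratedDeriv j (by exact_mod_cast le_top)
  have hderiv : ∀ j y, HasDerivAt (iteratedDeriv j g) (iteratedDeriv (j + 1) g y) y := by
    intro j y
    rw [iteratedDeriv_succ]
    exact ((hg.differentiable_iteratedDeriv j
      (by exact_mod_cast WithTop.coe_lt_top _)) y).hasDerivAt
  have hchain : ∀ c b s : ℝ, HasDerivAt (fun s => iteratedDeriv m g (c * s + b))
      (c * iteratedDeriv (m + 1) g (c * s + b)) s := by
    intro c b s
    have hlin : HasDerivAt (fun s => c * s + b) c s := by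
      simpa using ((hasDerivAt_id s).const_mul c).add_const b
    rw [mul_comm]
    exact (hderiv m _).comp s hlin
  have hint : ∀ z : Fin (m + 1) → ℝ, IntegrableOn (fun u => iteratedDeriv m g (simplexPoint z u))
      (orderedSimplex m) := fun z =>
    ((hcont m).comp (continuous_simplexPoint z)).continuousOn.integrableOn_compact
      (isCompact_orderedSimplex m)
  rw [divDiff_eq, divDiff_eq, divDiff_eq, ← integral_sub (hint _) (hint _),
    setIntegral_orderedSimplex_succ k (fun t => iteratedDeriv (m + 1) g (simplexPoint x t))
      ((hcont _).comp (continuous_simplexPoint x)),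
    ← integral_const_mul]
  refine setIntegral_congr_fun (measurableSet_orderedSimplex m) fun u _ => ?_
  obtain ⟨h1, h2⟩ := simplexPoint_insertNth_knot x k u
  rw [← h1, ← h2, ← intervalIntegral.integral_const_mul]
  refine intervalIntegral.integral_eq_sub_of_hasDerivAt
    (f := fun s => iteratedDeriv m g (simplexPoint x (k.insertNth s u))) (fun s _ => ?_) ?_
  · simp only [simplexPoint_insertNth]
    exact hchain _ _ s
  · refine Continuous.intervalIntegrable ?_ _ _
    simp only [simplexPoint_insertNth]
    have := hcont (m + 1)
    fun_prop

/-- Recursion for divided differences at two arbitrary nodes. -/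
theorem divDiff_recursion {g : ℝ → ℝ} (hg : ContDiff ℝ (⊤ : ℕ∞) g) {m : ℕ}
    (x : Fin (m + 2) → ℝ) (i j : Fin (m + 2)) :
    (x i - x j) * divDiff g x = divDiff g (x ∘ j.succAbove) - divDiff g (x ∘ i.succAbove) := by
  have key : ∀ i : Fin (m + 2), x i * divDiff g x + divDiff g (x ∘ i.succAbove) =
      x 0 * divDiff g x + divDiff g (x ∘ Fin.succAbove 0) := by
    intro i
    induction i using Fin.induction with
    | zero => rfl
    | succ k ih =>
      rw [← ih]
      linarith [divDiff_recursion_adjacent hg x k]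
  linarith [key i, key j]

theorem simplexPoint_mem {m : ℕ} {x : Fin (m + 1) → ℝ} {t : Fin m → ℝ}
    (ht : t ∈ orderedSimplex m) {s : Set ℝ} (hs : Convex ℝ s) (hx : ∀ i, x i ∈ s) :
    simplexPoint x t ∈ s := by
  have h1 := simplexPoint_eq_sum (fun _ => 1) t
  simp only [simplexPoint, sub_self, zero_mul, Finset.sum_const_zero, add_zero, one_mul] at h1
  rw [simplexPoint_eq_sum]
  simp only [mul_comm (x _)]
  exact hs.sum_mem (fun i _ => sub_nonneg.2 ((mem_orderedSimplex_iff t).1 ht (Nat.le_succ _)))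
    h1.symm fun i _ => hx i

theorem abs_divDiff_le {g : ℝ → ℝ} {m : ℕ} {x : Fin (m + 1) → ℝ} {s : Set ℝ} (hs : Convex ℝ s)
    (hx : ∀ i, x i ∈ s) {C : ℝ} (hC : ∀ y ∈ s, |iteratedDeriv m g y| ≤ C) :
    |divDiff g x| ≤ C * volume.real (orderedSimplex m) := by
  rw [divDiff_eq]
  exact norm_setIntegral_le_of_norm_le_const
    (f := fun t => iteratedDeriv m g (simplexPoint x t)) (isCompact_orderedSimplex m).measure_lt_top
    fun t ht => hC _ (simplexPoint_mem ht hs hx)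

theorem divDiff_single (g : ℝ → ℝ) (x : Fin 1 → ℝ) : divDiff g x = g (x 0) := by
  rw [divDiff_eq]
  have h : orderedSimplex 0 = Set.univ := by
    ext t; simp [orderedSimplex, Subsingleton.monotone]
  simp [h, simplexPoint, Measure.real, volume_pi]

theorem abs_divDiff_mul_prod_le_of_close {g : ℝ → ℝ} {a : ℝ} (ha : 1 ≤ a) {m : ℕ} {R c : ℝ}
    (hR : 0 < R) (hc : 0 < c)
    (hbd : ∀ y, R < |y| → |iteratedDeriv m g y| ≤ c * |y| ^ (-a - m))
    {x : Fin (m + 1) → ℝ} {M : ℝ} (hM : 2 * R < M) (hx0 : M ≤ |x 0|)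
    (hx : ∀ i, |x i - x 0| < |x 0| / 2) :
    |divDiff g x| * ∏ i, |x i| ≤
      c * volume.real (orderedSimplex m) * 4 ^ (m + 1) * (1 / 2) ^ (1 - a) * M ^ (1 - a) := by
  set r := |x 0| / 2 with hr
  have hr0 : 0 < r := by rw [hr]; linarith
  have h1 : |divDiff g x| ≤ c * r ^ (-a - m) * volume.real (orderedSimplex m) := by
    refine abs_divDiff_le (convex_ball (x 0) r) (fun i => by
      simpa [Real.dist_eq] using hx i) fun y hy => ?_
    rw [Metric.mem_ball, Real.dist_eq] at hy
    have hy' : r ≤ |y| := by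
      have := abs_sub_abs_le_abs_sub (x 0) y
      rw [abs_sub_comm] at this
      linarith
    refine (hbd y (by linarith)).trans (mul_le_mul_of_nonneg_left ?_ hc.le)
    exact Real.rpow_le_rpow_of_nonpos hr0 hy' (by linarith [(Nat.cast_nonneg m : (0 : ℝ) ≤ m)])
  have h2 : ∏ i, |x i| ≤ (4 * r) ^ (m + 1) := by
    refine (Finset.prod_le_prod (g := fun _ => 4 * r) (fun i _ => abs_nonneg _)
      fun i _ => ?_).trans_eq (by simp)
    have := abs_sub_abs_le_abs_sub (x i) (x 0)
    linarith [hx i]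
  have h3 : r ^ (-a - m) * r ^ (m + 1) = r ^ (1 - a) := by
    rw [← Real.rpow_natCast r (m + 1), ← Real.rpow_add hr0]
    congr 1
    push_cast
    ring
  have h4 : r ^ (1 - a) ≤ (1 / 2) ^ (1 - a) * M ^ (1 - a) := by
    rw [← Real.mul_rpow (by norm_num) (by linarith)]
    exact Real.rpow_le_rpow_of_nonpos (by linarith) (by linarith) (by linarith)
  calc |divDiff g x| * ∏ i, |x i|
      ≤ (c * r ^ (-a - m) * volume.real (orderedSimplex m)) * (4 * r) ^ (m + 1) :=
        mul_le_mul h1 h2 (by positivity) (by positivity)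
    _ = c * volume.real (orderedSimplex m) * 4 ^ (m + 1) * r ^ (1 - a) := by
        rw [← h3, mul_pow]; ring
    _ ≤ c * volume.real (orderedSimplex m) * 4 ^ (m + 1) *
          ((1 / 2) ^ (1 - a) * M ^ (1 - a)) := by gcongr
    _ = _ := by ring

theorem exists_abs_divDiff_mul_prod_le {g : ℝ → ℝ} (hg : ContDiff ℝ (⊤ : ℕ∞) g) {a : ℝ}
    (ha : 1 ≤ a)
    (hbd : ∀ k : ℕ, ∃ R c : ℝ, 0 < R ∧ 0 < c ∧
      ∀ y, R < |y| → |iteratedDeriv k g y| ≤ c * |y| ^ (-a - k)) (m : ℕ) :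
    ∃ R C : ℝ, 0 < R ∧ 0 < C ∧ ∀ (x : Fin (m + 1) → ℝ) (M : ℝ), R < M → (∀ i, M ≤ |x i|) →
      |divDiff g x| * ∏ i, |x i| ≤ C * M ^ (1 - a) := by
  induction m with
  | zero =>
    obtain ⟨R, c, hR, hc, h⟩ := hbd 0
    refine ⟨R, c, hR, hc, fun x M hM hx => ?_⟩
    have h0 := hx 0
    have hpos : 0 < |x 0| := by linarith
    have h1 := h (x 0) (by linarith)
    simp only [iteratedDeriv_zero, Nat.cast_zero, sub_zero] at h1
    have hprod : ∏ i, |x i| = |x 0| := Fin.prod_univ_one _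
    rw [divDiff_single, hprod]
    calc |g (x 0)| * |x 0| ≤ c * |x 0| ^ (-a) * |x 0| := by gcongr
      _ = c * |x 0| ^ (1 - a) := by
        rw [mul_assoc, ← Real.rpow_add_one hpos.ne', neg_add_eq_sub]
      _ ≤ c * M ^ (1 - a) := mul_le_mul_of_nonneg_left
        (Real.rpow_le_rpow_of_nonpos (by linarith) h0 (by linarith)) hc.le
  | succ m ih =>
    obtain ⟨R₁, C, hR₁, hC, hfar⟩ := ih
    obtain ⟨R₂, c, hR₂, hc, hclose⟩ := hbd (m + 1)
    set K := c * volume.real (orderedSimplex (m + 1)) * 4 ^ (m + 1 + 1) * (1 / 2) ^ (1 - a) with hK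
    have hK0 : 0 ≤ K := by positivity
    refine ⟨max R₁ (2 * R₂), 6 * C + K, by positivity, by positivity, fun x M hM hx => ?_⟩
    have hM1 : R₁ < M := (le_max_left _ _).trans_lt hM
    have hM2 : 2 * R₂ < M := (le_max_right _ _).trans_lt hM
    have hMa : 0 < M ^ (1 - a) := Real.rpow_pos_of_pos (by linarith) _
    by_cases hx' : ∀ i, |x i - x 0| < |x 0| / 2
    · refine (abs_divDiff_mul_prod_le_of_close ha hR₂ hc hclose hM2 (hx 0) hx').trans ?_
      rw [← hK]
      gcongr
      linarith
    · push Not at hx'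
      obtain ⟨i, hi⟩ := hx'
      set d := |x i - x 0| with hd
      have hx0 : |x 0| ≤ 3 * d := by linarith [abs_nonneg (x 0)]
      have hxi : |x i| ≤ 3 * d := by
        have := abs_sub_abs_le_abs_sub (x i) (x 0)
        linarith
      have hd0 : 0 < d := by linarith [hx 0]
      have hrec := congrArg abs (divDiff_recursion hg x i 0)
      rw [abs_mul, ← hd] at hrec
      have e : ∀ j : Fin (m + 2), |x j| ≤ 3 * d →
          |divDiff g (x ∘ j.succAbove)| * ∏ l, |x l| ≤ 3 * d * (C * M ^ (1 - a)) := by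
        intro j hj
        have := hfar (x ∘ j.succAbove) M hM1 fun l => hx _
        rw [Fin.prod_univ_succAbove _ j]
        calc _ = |x j| * (|divDiff g (x ∘ j.succAbove)| * ∏ l, |(x ∘ j.succAbove) l|) := by
              simp only [Function.comp]; ring
          _ ≤ _ := mul_le_mul hj this (by positivity) (by positivity)
      have hP : 0 ≤ ∏ l, |x l| := by positivity
      have h1 : d * (|divDiff g x| * ∏ l, |x l|) ≤ d * (6 * C * M ^ (1 - a)) := by
        rw [← mul_assoc, hrec]
        have := mul_le_mul_of_nonneg_right (abs_sub (divDiff g (x ∘ Fin.succAbove 0))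
          (divDiff g (x ∘ i.succAbove))) hP
        linarith [e 0 hx0, e i hxi]
      refine (le_of_mul_le_mul_left h1 hd0).trans ?_
      gcongr
      linarith

theorem exists_abs_divDiff_cons_mul_prod_le {g : ℝ → ℝ} (hg : ContDiff ℝ (⊤ : ℕ∞) g) {a : ℝ}
    (ha : 1 ≤ a)
    (hbd : ∀ k : ℕ, ∃ R c : ℝ, 0 < R ∧ 0 < c ∧
      ∀ y, R < |y| → |iteratedDeriv k g y| ≤ c * |y| ^ (-a - k))
    {z : ℝ} (hz : g z = 0) (n : ℕ) :
    ∃ R C : ℝ, 0 < R ∧ 0 < C ∧ ∀ (x : Fin n → ℝ) (M : ℝ), R < M → (∀ i, M ≤ |x i|) →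
      |divDiff g (Fin.cons z x : Fin (n + 1) → ℝ)| * ∏ i, |x i| ≤ C * M ^ (-a) := by
  induction n with
  | zero =>
    refine ⟨1, 1, one_pos, one_pos, fun x M hM _ => ?_⟩
    rw [divDiff_single]
    simp only [Fin.cons_zero, hz, abs_zero, zero_mul, one_mul]
    exact Real.rpow_nonneg (by linarith) _
  | succ n ih =>
    obtain ⟨R₁, C₁, hR₁, hC₁, h₁⟩ := ih
    obtain ⟨R₂, C₂, hR₂, hC₂, h₂⟩ := exists_abs_divDiff_mul_prod_le hg ha hbd n
    refine ⟨max (max R₁ R₂) (2 * |z|), 2 * (C₁ + C₂), by positivity, by positivity,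
      fun x M hM hx => ?_⟩
    have hM1 : R₁ < M := ((le_max_left _ _).trans (le_max_left _ _)).trans_lt hM
    have hM2 : R₂ < M := ((le_max_right _ _).trans (le_max_left _ _)).trans_lt hM
    have hM3 : 2 * |z| < M := (le_max_right _ _).trans_lt hM
    have hM0 : 0 < M := by linarith
    have hx0 := hx 0
    have hrec := congrArg abs
      (divDiff_recursion hg (Fin.cons z x : Fin (n + 2) → ℝ) 1 0)
    have hcomp0 : (Fin.cons z x : Fin (n + 2) → ℝ) ∘ Fin.succAbove 0 = x := by
      ext l; simp
    have hcomp1 : (Fin.cons z x : Fin (n + 2) → ℝ) ∘ Fin.succAbove 1 =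
        Fin.cons z (x ∘ Fin.succ) := by
      ext l
      refine Fin.cases ?_ (fun l => ?_) l
      · simp
      · have : (1 : Fin (n + 2)).succAbove l.succ = l.succ.succ := by
          rw [← Fin.succ_zero_eq_one, Fin.succ_succAbove_succ, Fin.zero_succAbove]
        simp [this]
    have hone : (Fin.cons z x : Fin (n + 2) → ℝ) 1 = x 0 := rfl
    rw [hcomp0, hcomp1, hone, Fin.cons_zero, abs_mul] at hrec
    set E := |divDiff g (Fin.cons z x : Fin (n + 2) → ℝ)| with hE
    have hd : |x 0| ≤ 2 * |x 0 - z| := by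
      have := abs_sub_abs_le_abs_sub (x 0) z
      linarith
    have hE1 := h₁ (x ∘ Fin.succ) M hM1 fun l => hx _
    have hE2 := h₂ x M hM2 hx
    simp only [Function.comp_apply] at hE1
    set P := ∏ l : Fin n, |x l.succ| with hP
    have hP0 : 0 ≤ P := by positivity
    rw [Fin.prod_univ_succ, ← hP] at hE2 ⊢
    have hE3 : |divDiff g x| * P ≤ C₂ * M ^ (-a) := by
      have e : M ^ (1 - a) = M * M ^ (-a) := by
        rw [sub_eq_add_neg, Real.rpow_add hM0, Real.rpow_one]
      rw [e] at hE2
      refine le_of_mul_le_mul_left ?_ hM0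
      have := mul_le_mul_of_nonneg_right hx0 (by positivity : 0 ≤ |divDiff g x| * P)
      linarith
    have hEx : E * |x 0| ≤ 2 * (|divDiff g x| +
        |divDiff g (Fin.cons z (x ∘ Fin.succ) : Fin (n + 1) → ℝ)|) := by
      have h := mul_le_mul_of_nonneg_left hd (abs_nonneg _ : 0 ≤ E)
      have := abs_sub (divDiff g x) (divDiff g (Fin.cons z (x ∘ Fin.succ) : Fin (n + 1) → ℝ))
      linarith
    have := mul_le_mul_of_nonneg_right hEx hP0
    linarith

/-- if `f'` has precise order `−p−1` (`p ≥ 0`), `f'(λ₀) = 0` and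
`n ≥ 1`, then there are `R, c₂ > 0` such that for all `R < |x_1| ≤ ⋯ ≤ |x_n|` one has
`|f'{λ₀, x_1, …, x_n}| ≤ c₂ |x_1|^(−p−1)`. -/
theorem statement11 (p : ℝ) (hp : 0 ≤ p) (f : ℝ → ℝ) (hf : ContDiff ℝ (⊤ : ℕ∞) f)
    (hord : PreciseOrder (deriv f) (-p - 1)) (lam0 : ℝ) (hzero : deriv f lam0 = 0)
    (n : ℕ) (hn : 1 ≤ n) :
    ∃ R c₂ : ℝ, 0 < R ∧ 0 < c₂ ∧
      ∀ x : Fin n → ℝ, R < |x ⟨0, hn⟩| → (Monotone fun j => |x j|) →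
        |wDivDiff f (Fin.cons lam0 x)| ≤ c₂ * |x ⟨0, hn⟩| ^ (-p - 1) := by
  have hg : ContDiff ℝ (⊤ : ℕ∞) (deriv f) := by
    have : ContDiff ℝ ((⊤ : ℕ∞) + 1) f := by simpa using hf
    exact (contDiff_succ_iff_deriv.1 this).2.2
  have hbd : ∀ k : ℕ, ∃ R c : ℝ, 0 < R ∧ 0 < c ∧
      ∀ y, R < |y| → |iteratedDeriv k (deriv f) y| ≤ c * |y| ^ (-(p + 1) - k) := by
    intro k
    obtain ⟨R, c₁, c₂, hR, -, hc₂, h⟩ := hord k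
    refine ⟨R, c₂, hR, hc₂, fun y hy => ?_⟩
    rw [neg_add']
    exact (h y hy).2
  obtain ⟨R, C, hR, hC, h⟩ :=
    exists_abs_divDiff_cons_mul_prod_le hg (by linarith : 1 ≤ p + 1) hbd hzero n
  refine ⟨R, (|lam0| + 1) * C, hR, by positivity, fun x hx hmono => ?_⟩
  have hb := h x |x ⟨0, hn⟩| hx fun i => hmono (Fin.mk_le_of_le_val (Nat.zero_le _))
  rw [neg_add'] at hb
  have hpow : 0 ≤ |x ⟨0, hn⟩| ^ (-p - 1) := Real.rpow_nonneg (abs_nonneg _) _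
  have e : |wDivDiff f (Fin.cons lam0 x)| = |lam0| *
      (|divDiff (deriv f) (Fin.cons lam0 x : Fin (n + 1) → ℝ)| * ∏ i, |x i|) := by
    rw [wDivDiff, abs_mul, abs_mul, abs_pow, abs_neg, abs_one, one_pow, Fin.prod_univ_succ,
      abs_mul, Finset.abs_prod]
    simp only [Fin.cons_zero, Fin.cons_succ]
    ring
  rw [e, mul_assoc]
  gcongr
  linarith
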